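/- Let Y = ∑_{i=1}^m a_i Y_i where the Y_i are independent uniform ±1 random variables and a_i ∈ ℝ. Then Pr[|Y| ≥ (1/√2)·(∑_i a_i²)^{1/2}] ≥ 1/4. -/

import Mathlib

/-- Rademacher sign from a boolean. -/
def rsign (b : Bool) : ℝ := if b then 1 else -1

/-- Expectation of `f (x + R)`, where `R` is the random signed sum of the entries of the list. -/
noncomputable def signedMean (f : ℝ → ℝ) : List ℝ → ℝ → ℝ
  | [], x => f x
  | a :: l, x => (signedMean f l (x + a) + signedMean f l (x - a)) / 2

namespace signedMean

variable {f g : ℝ → ℝ}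

theorem perm {l l' : List ℝ} (h : l.Perm l') (x : ℝ) : signedMean f l x = signedMean f l' x := by
  induction h generalizing x with
  | nil => rfl
  | cons a _ ih => simp only [signedMean, ih]
  | swap a b l =>
    simp only [signedMean]
    rw [show x + b - a = x - a + b by ring, show x - b + a = x + a - b by ring,
      show x + b + a = x + a + b by ring, show x - b - a = x - a - b by ring]
    ring
  | trans _ _ ih₁ ih₂ => rw [ih₁, ih₂]

theorem append (l l' : List ℝ) (x : ℝ) :
    signedMean f (l ++ l') x = signedMean (signedMean f l') l x := by
  induction l generalizing x with
  | nil => rfl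
  | cons a l ih => simp only [List.cons_append, signedMean, ih]

theorem mono (h : ∀ y, f y ≤ g y) (l : List ℝ) (x : ℝ) : signedMean f l x ≤ signedMean g l x := by
  induction l generalizing x with
  | nil => exact h x
  | cons a l ih => simp only [signedMean]; linarith [ih (x + a), ih (x - a)]

theorem const (c : ℝ) (l : List ℝ) (x : ℝ) : signedMean (fun _ => c) l x = c := by
  induction l generalizing x with
  | nil => rfl
  | cons a l ih => simp only [signedMean, ih]; ring

theorem add (l : List ℝ) (x : ℝ) :
    signedMean (fun y => f y + g y) l x = signedMean f l x + signedMean g l x := by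
  induction l generalizing x with
  | nil => rfl
  | cons a l ih => simp only [signedMean, ih]; ring

theorem sub (l : List ℝ) (x : ℝ) :
    signedMean (fun y => f y - g y) l x = signedMean f l x - signedMean g l x := by
  induction l generalizing x with
  | nil => rfl
  | cons a l ih => simp only [signedMean, ih]; ring

theorem translate (l : List ℝ) (z x : ℝ) :
    signedMean (fun y => f (z + y)) l x = signedMean f l (z + x) := by
  induction l generalizing x with
  | nil => rfl
  | cons a l ih => simp only [signedMean, ih, add_assoc, add_sub_assoc]

theorem comp_neg (l : List ℝ) (x : ℝ) :
    signedMean (fun y => f (-y)) l x = signedMean f l (-x) := by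
  induction l generalizing x with
  | nil => rfl
  | cons a l ih =>
    simp only [signedMean, ih]
    rw [show -(x + a) = -x - a by ring, show -(x - a) = -x + a by ring, add_comm]

theorem map_abs (l : List ℝ) (x : ℝ) :
    signedMean f (l.map fun a => |a|) x = signedMean f l x := by
  induction l generalizing x with
  | nil => rfl
  | cons a l ih =>
    simp only [List.map_cons, signedMean, ih]
    rcases abs_choice a with h | h <;> rw [h]
    rw [sub_neg_eq_add, ← sub_eq_add_neg, add_comm]

end signedMean

/-- The sum of the `s` largest binomial coefficients `n.choose k`. -/
def middleSum : ℕ → ℕ → ℕ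
  | 0, s => min 1 s
  | _ + 1, 0 => 0
  | n + 1, s + 1 => middleSum n (s + 2) + middleSum n s

/-- One step of the symmetric chain construction: the signed sums `y ± a`, for `y` in a decreasing
block, are rearranged into two decreasing blocks. -/
noncomputable def splitBlock (a : ℝ) : List ℝ → List (List ℝ)
  | [] => [[], []]
  | z :: t => [(z + a) :: (z :: t).map (· - a), t.map (· + a)]

theorem pairwise_splitBlock {a β : ℝ} (hβ : 0 < β) (ha : β ≤ a) {b : List ℝ}
    (hb : b.Pairwise fun x y => y + 2 * β ≤ x) :
    ∀ b' ∈ splitBlock a b, b'.Pairwise fun x y => y + 2 * β ≤ x := by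
  have hmap : ∀ (t : List ℝ) (e : ℝ), (t.Pairwise fun x y => y + 2 * β ≤ x) →
      (t.map (· + e)).Pairwise fun x y => y + 2 * β ≤ x := by
    intro t e ht
    rw [List.pairwise_map]
    exact ht.imp fun h => by linarith
  cases b with
  | nil => simp [splitBlock]
  | cons z t =>
    intro b' hb'
    simp only [splitBlock, List.mem_cons, List.not_mem_nil, or_false] at hb'
    rcases hb' with rfl | rfl
    · refine List.pairwise_cons.2 ⟨?_, by simpa [sub_eq_add_neg] using hmap (z :: t) (-a) hb⟩
      intro y hy
      obtain ⟨w, hw, rfl⟩ := List.mem_map.1 hy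
      rcases List.mem_cons.1 hw with rfl | hw
      · linarith
      · have := (List.pairwise_cons.1 hb).1 w hw
        linarith
    · exact hmap t a (List.pairwise_cons.1 hb).2

theorem sum_splitBlock (h : ℝ → ℝ) (a : ℝ) (b : List ℝ) :
    ((splitBlock a b).map fun b' => (b'.map h).sum).sum =
      (b.map fun y => h (y + a)).sum + (b.map fun y => h (y - a)).sum := by
  cases b with
  | nil => simp [splitBlock]
  | cons z t => simp [splitBlock, Function.comp_def]; ring

theorem length_splitBlock (a : ℝ) (s : ℕ) (b : List ℝ) :
    ((splitBlock a b).map fun b' => min b'.length (s + 1)).sum =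
      min b.length (s + 2) + min b.length s := by
  cases b with
  | nil => simp [splitBlock]
  | cons z t => simp [splitBlock]; omega

theorem exists_blocks {β : ℝ} (hβ : 0 < β) (l : List ℝ) (hl : ∀ a ∈ l, β ≤ a) :
    ∃ B : List (List ℝ), (∀ b ∈ B, b.Pairwise fun x y => y + 2 * β ≤ x) ∧
      (∀ (f : ℝ → ℝ) (x : ℝ), 2 ^ l.length * signedMean f l x =
        (B.map fun b => (b.map fun y => f (x + y)).sum).sum) ∧
      ∀ s, (B.map fun b => min b.length s).sum = middleSum l.length s := by
  induction l with
  | nil => exact ⟨[[0]], by simp, by simp [signedMean], by simp [middleSum]⟩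
  | cons a l ih =>
    obtain ⟨B, hB, hsum, hlen⟩ := ih fun b hb => hl b (List.mem_cons_of_mem _ hb)
    refine ⟨B.flatMap (splitBlock a), ?_, ?_, ?_⟩
    · intro b hb
      obtain ⟨b', hb', h⟩ := List.mem_flatMap.1 hb
      exact pairwise_splitBlock hβ (hl a List.mem_cons_self) (hB b' hb') b h
    · intro f x
      have key : ∀ B' : List (List ℝ),
          ((B'.flatMap (splitBlock a)).map fun b => (b.map fun y => f (x + y)).sum).sum =
            (B'.map fun b => (b.map fun y => f (x + a + y)).sum).sum +
              (B'.map fun b => (b.map fun y => f (x - a + y)).sum).sum := by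
        intro B'
        induction B' with
        | nil => simp
        | cons b B' ih =>
          simp only [List.flatMap_cons, List.map_append, List.sum_append, List.map_cons,
            List.sum_cons, ih, sum_splitBlock]
          simp only [show ∀ y, x + (y + a) = x + a + y by intro y; ring,
            show ∀ y, x + (y - a) = x - a + y by intro y; ring]
          ring
      rw [key, ← hsum, ← hsum]
      simp only [List.length_cons, signedMean, pow_succ]
      ring
    · intro s
      cases s with
      | zero => simp [middleSum]
      | succ s =>
        rw [List.length_cons, middleSum, ← hlen, ← hlen]
        clear hsum hlen hB
        induction B with
        | nil => simp
        | cons b B ih =>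
          simp only [List.flatMap_cons, List.map_append, List.sum_append, List.map_cons,
            List.sum_cons, ih, length_splitBlock]
          ring

theorem sum_indicator_block_le {β : ℝ} (b : List ℝ)
    (hb : b.Pairwise fun x y => y + 2 * β ≤ x) (x u : ℝ) (s : ℕ) :
    (b.map fun y => (Set.Ico u (u + 2 * s * β)).indicator 1 (x + y)).sum ≤
      ((min b.length s : ℕ) : ℝ) := by
  induction b generalizing s with
  | nil => simp
  | cons z t ih =>
    have ih := ih (List.pairwise_cons.1 hb).2
    have hz := (List.pairwise_cons.1 hb).1
    simp only [List.map_cons, List.sum_cons, List.length_cons]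
    by_cases h : x + z ∈ Set.Ico u (u + 2 * s * β)
    · rw [Set.indicator_of_mem h]
      cases s with
      | zero => simp at h
      | succ s =>
        have hle : (t.map fun y => (Set.Ico u (u + 2 * (s + 1 : ℕ) * β)).indicator
            (1 : ℝ → ℝ) (x + y)).sum ≤
            (t.map fun y => (Set.Ico u (u + 2 * s * β)).indicator 1 (x + y)).sum := by
          apply List.sum_le_sum
          intro y hy
          have := hz y hy
          have h2 := h.2
          push_cast at h2
          simp only [Set.indicator_apply, Set.mem_Ico, Pi.one_apply]
          split_ifs with h3 h4 h4
          · exact le_rfl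
          · exact absurd ⟨h3.1, by linarith⟩ h4
          · norm_num
          · exact le_rfl
        have := ih s
        rw [Nat.add_min_add_right]
        push_cast at *
        simp only [Pi.one_apply]
        linarith
    · rw [Set.indicator_of_notMem h, zero_add]
      refine (ih s).trans ?_
      exact_mod_cast min_le_min_right s (Nat.le_succ _)

theorem signedMean_indicator_le_of_forall {β : ℝ} (hβ : 0 < β) (l : List ℝ)
    (hl : ∀ a ∈ l, β ≤ a) (x u : ℝ) (s : ℕ) :
    signedMean ((Set.Ico u (u + 2 * s * β)).indicator 1) l x ≤
      middleSum l.length s / 2 ^ l.length := by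
  obtain ⟨B, hB, hsum, hlen⟩ := exists_blocks hβ l hl
  rw [le_div_iff₀ (by positivity), mul_comm, hsum, ← hlen]
  clear hsum hlen
  induction B with
  | nil => simp
  | cons b B ih =>
    simp only [List.map_cons, List.sum_cons, Nat.cast_add]
    exact add_le_add (sum_indicator_block_le b (hB b List.mem_cons_self) x u s)
      (ih fun b' hb' => hB b' (List.mem_cons_of_mem _ hb'))

open Classical in
/-- The number of entries of `l` that are at least `t`. -/
noncomputable def countGE (t : ℝ) (l : List ℝ) : ℕ := l.countP fun a => t ≤ a

/-- The Erdős–Littlewood–Offord inequality. -/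
theorem signedMean_indicator_le {β : ℝ} (hβ : 0 < β) (l : List ℝ) {j : ℕ}
    (hj : j ≤ countGE β l) (x u : ℝ) (s : ℕ) :
    signedMean ((Set.Ico u (u + 2 * s * β)).indicator 1) l x ≤ middleSum j s / 2 ^ j := by
  classical
  set P : ℝ → Bool := fun a => β ≤ a with hP
  have hlen : ((l.filter P).take j).length = j := by
    rw [List.length_take, ← List.countP_eq_length_filter]
    exact min_eq_left (by simpa [countGE, hP] using hj)
  have hperm : l.Perm (((l.filter P).drop j ++ l.filter fun a => !P a) ++ (l.filter P).take j) := by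
    refine (List.filter_append_perm P l).symm.trans ?_
    nth_rewrite 1 [← List.take_append_drop j (l.filter P)]
    rw [List.append_assoc]
    exact List.perm_append_comm
  rw [signedMean.perm hperm, signedMean.append]
  refine (signedMean.mono (g := fun _ => (middleSum j s / 2 ^ j : ℝ)) (fun y => ?_) _ x).trans
    (signedMean.const _ _ x).le
  have := signedMean_indicator_le_of_forall hβ ((l.filter P).take j) (fun a ha => by
    simpa [hP] using (List.mem_filter.1 (List.mem_of_mem_take ha)).2) y u s
  rwa [hlen] at this

/-- The probability that the signed sum of the list, started at `x`, has modulus at least `1`. -/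
noncomputable def tailProb (l : List ℝ) (x : ℝ) : ℝ :=
  signedMean ({y | 1 ≤ |y|}.indicator 1) l x

theorem tailProb_cons (a : ℝ) (l : List ℝ) (x : ℝ) :
    tailProb (a :: l) x = (tailProb l (x + a) + tailProb l (x - a)) / 2 := rfl

theorem tailProb_perm {l l' : List ℝ} (h : l.Perm l') (x : ℝ) : tailProb l x = tailProb l' x :=
  signedMean.perm h x

theorem tailProb_neg (l : List ℝ) (x : ℝ) : tailProb l (-x) = tailProb l x := by
  rw [tailProb, tailProb, ← signedMean.comp_neg]
  congr 1
  ext y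
  simp [Set.indicator_apply]

theorem tailProb_nonneg (l : List ℝ) (x : ℝ) : 0 ≤ tailProb l x := by
  rw [← signedMean.const 0 l x]
  exact signedMean.mono (fun y => Set.indicator_nonneg (fun _ _ => zero_le_one) y) l x

theorem le_two_mul_tailProb {l : List ℝ} {x : ℝ} {g : ℝ → ℝ}
    (h : ∀ y, g y ≤ {y : ℝ | 1 ≤ |y|}.indicator 1 (x + y) +
      {y : ℝ | 1 ≤ |y|}.indicator 1 (x - y)) : signedMean g l 0 ≤ 2 * tailProb l x := by
  refine (signedMean.mono h l 0).trans_eq ?_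
  rw [signedMean.add, signedMean.translate, add_zero]
  have := signedMean.comp_neg (f := fun y => {y : ℝ | 1 ≤ |y|}.indicator 1 (x + y)) l 0
  simp only [← sub_eq_add_neg] at this
  rw [this, signedMean.translate, neg_zero, add_zero, tailProb]
  ring

theorem half_le_tailProb (l : List ℝ) {x : ℝ} (hx : 1 ≤ |x|) : 1 / 2 ≤ tailProb l x := by
  have : signedMean (fun _ => 1) l 0 ≤ 2 * tailProb l x := by
    refine le_two_mul_tailProb fun y => ?_
    simp only [Set.indicator_apply, Set.mem_ofPred_eq, Pi.one_apply]
    have : 1 ≤ |x + y| ∨ 1 ≤ |x - y| := by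
      by_contra! h
      rw [abs_lt, abs_lt] at h
      rcases le_abs.1 hx with h' | h' <;> linarith [h.1.1, h.1.2, h.2.1, h.2.2]
    rcases this with h | h
    · rw [if_pos h]; split_ifs <;> norm_num
    · rw [if_pos h]; split_ifs <;> norm_num
  rw [signedMean.const] at this
  linarith

theorem le_tailProb_of_countGE {l : List ℝ} {x : ℝ} (hx : |x| < 1) {j : ℕ}
    (hj : j ≤ countGE (1 - |x|) l) : (1 - middleSum j 1 / 2 ^ j) / 2 ≤ tailProb l x := by
  have hd : 0 < 1 - |x| := by linarith
  have h1 := signedMean_indicator_le hd l hj 0 (-(1 - |x|)) 1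
  set I := Set.Ico (-(1 - |x|)) (-(1 - |x|) + 2 * (1 : ℕ) * (1 - |x|)) with hI
  have : signedMean (fun y => 1 - I.indicator 1 y) l 0 ≤ 2 * tailProb l x := by
    refine le_two_mul_tailProb fun y => ?_
    simp only [Set.indicator_apply, Set.mem_ofPred_eq, Pi.one_apply]
    by_cases hy : y ∈ I
    · rw [if_pos hy]; split_ifs <;> norm_num
    have : 1 ≤ |x + y| ∨ 1 ≤ |x - y| := by
      by_contra! h
      refine hy ?_
      rw [abs_lt, abs_lt] at h
      simp only [hI, Set.mem_Ico]
      push_cast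
      rcases abs_cases x with h' | h' <;> constructor <;>
        linarith [h.1.1, h.1.2, h.2.1, h.2.2, h'.1, h'.2]
    rw [if_neg hy]
    rcases this with h | h
    · rw [if_pos h]; split_ifs <;> norm_num
    · rw [if_pos h]; split_ifs <;> norm_num
  rw [signedMean.sub, signedMean.const] at this
  linarith

theorem le_tailProb_zero_of_countGE (l : List ℝ) {s j : ℕ} (hs : 0 < s)
    (hj : j ≤ countGE (1 / s) l) : 1 - (middleSum j s / 2 ^ j : ℝ) ≤ tailProb l 0 := by
  have hs' : (0 : ℝ) < s := by exact_mod_cast hs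
  have h1 := signedMean_indicator_le (one_div_pos.2 hs') l hj 0 (-1) s
  rw [show -1 + 2 * (s : ℝ) * (1 / s) = 1 by field_simp; norm_num] at h1
  have h2 : signedMean (fun y => 1 - (Set.Ico (-1) 1).indicator 1 y) l 0 ≤ tailProb l 0 := by
    refine signedMean.mono (fun y => ?_) l 0
    simp only [Set.indicator_apply, Set.mem_ofPred_eq, Pi.one_apply]
    by_cases hy : y ∈ Set.Ico (-1 : ℝ) 1
    · rw [if_pos hy]; split_ifs <;> norm_num
    · rw [if_neg hy, if_pos]
      · norm_num
      · by_contra! h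
        rw [abs_lt] at h
        exact hy ⟨h.1.le, h.2⟩
  rw [signedMean.sub, signedMean.const] at h2
  linarith

/-- The sum of the squares of the entries. -/
def sumSq (l : List ℝ) : ℝ := (l.map (· ^ 2)).sum

@[simp] theorem sumSq_nil : sumSq [] = 0 := rfl

@[simp] theorem sumSq_cons (a : ℝ) (l : List ℝ) : sumSq (a :: l) = a ^ 2 + sumSq l := by
  simp [sumSq]

theorem sumSq_perm {l l' : List ℝ} (h : l.Perm l') : sumSq l = sumSq l' :=
  (h.map _).sum_eq

theorem sumSq_nonneg (l : List ℝ) : 0 ≤ sumSq l := by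
  induction l with
  | nil => simp
  | cons a l ih => rw [sumSq_cons]; positivity

theorem sumSq_le_of_sublist {l l' : List ℝ} (h : l'.Sublist l) : sumSq l' ≤ sumSq l := by
  induction h with
  | slnil => rfl
  | cons a _ ih => rw [sumSq_cons]; nlinarith [sq_nonneg a]
  | cons_cons a _ ih => simpa using ih

/-- A lower bound for `tailProb l x` in terms of `x` and `V = sumSq l`. -/
noncomputable def potential (D x V : ℝ) : ℝ :=
  (x ^ 2 + V - 1) / 4 + D * (-10 + 11 * (x ^ 2 + V) - 3 * (x ^ 2 + V) ^ 2 + 2 * x ^ 4)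

theorem potential_neg (D x V : ℝ) : potential D (-x) V = potential D x V := by
  simp only [potential]; ring

theorem potential_le_tailProb_cons {D x a : ℝ} {l : List ℝ} (hD : 0 ≤ D)
    (h₁ : potential D (x + a) (sumSq l) ≤ tailProb l (x + a))
    (h₂ : potential D (x - a) (sumSq l) ≤ tailProb l (x - a)) :
    potential D x (sumSq (a :: l)) ≤ tailProb (a :: l) x := by
  rw [tailProb_cons, sumSq_cons]
  refine le_trans ?_ (div_le_div_of_nonneg_right (add_le_add h₁ h₂) zero_le_two)
  have : 0 ≤ D * a ^ 4 := by positivity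
  simp only [potential]
  nlinarith

theorem potential_le_of_abs_lt {D x V : ℝ} (hD : 0 ≤ D) (hD' : D ≤ 1 / 12) (hx : |x| < 1)
    (hV : V ≤ 2) : potential D x V ≤ V / 4 + D * (5 * V - 3 * V ^ 2) := by
  have h1 : x ^ 2 < 1 := (sq_lt_one_iff_abs_lt_one x).2 hx
  have h2 : D * (-10 + x ^ 2 + 6 * V) ≤ 1 / 12 * 3 :=
    (mul_le_mul_of_nonneg_left (by linarith) hD).trans
      (mul_le_mul_of_nonneg_right hD' (by norm_num))
  have h3 : 0 ≤ (1 - x ^ 2) * (1 / 4 - D * (-10 + x ^ 2 + 6 * V)) :=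
    mul_nonneg (by linarith) (by linarith)
  simp only [potential]
  linarith

theorem potential_zero_le {D x : ℝ} (hD : 0 ≤ D) (hx : |x| < 1) : potential D x 0 ≤ 0 := by
  have h1 : x ^ 2 < 1 := (sq_lt_one_iff_abs_lt_one x).2 hx
  have : potential D x 0 = -((1 - x ^ 2) * (1 / 4 + D * (10 - x ^ 2))) := by
    simp only [potential]; ring
  rw [this, neg_nonpos]
  have : 0 ≤ 10 - x ^ 2 := by linarith
  have : 0 ≤ 1 - x ^ 2 := by linarith
  positivity

theorem countGE_eq_length {d : ℝ} {l : List ℝ} (h : ∀ a ∈ l, d ≤ a) : countGE d l = l.length := by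
  classical
  rw [countGE, List.countP_eq_length]
  simpa using h

theorem potential_le_tailProb {D : ℝ} (hD : 0 ≤ D) (hD' : D ≤ 1 / 12) (l : List ℝ)
    (hV : sumSq l ≤ 2) (hpos : ∀ a ∈ l, 0 ≤ a)
    (H : ∀ l' : List ℝ, l'.Sublist l → l' ≠ [] → ∃ j ≤ l'.length,
      sumSq l' / 4 + D * (5 * sumSq l' - 3 * sumSq l' ^ 2) ≤ (1 - middleSum j 1 / 2 ^ j) / 2)
    {x : ℝ} (hx : |x| < 1) : potential D x (sumSq l) ≤ tailProb l x := by
  induction hn : l.length generalizing l x with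
  | zero =>
    rw [List.length_eq_zero_iff] at hn
    subst hn
    exact (potential_zero_le hD hx).trans (tailProb_nonneg _ _)
  | succ n ih =>
    by_cases h : ∀ a ∈ l, 1 - |x| ≤ a
    · obtain ⟨j, hj, hle⟩ := H l (List.Sublist.refl l) (by rintro rfl; simp at hn)
      exact (potential_le_of_abs_lt hD hD' hx hV).trans (hle.trans
        (le_tailProb_of_countGE hx (by rwa [countGE_eq_length h])))
    · push Not at h
      obtain ⟨a, ha, hlt⟩ := h
      have hp := List.perm_cons_erase ha
      have hs : (l.erase a).Sublist l := List.erase_sublist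
      have ha0 := hpos a ha
      have hfit : ∀ y, |y| < 1 → potential D y (sumSq (l.erase a)) ≤ tailProb (l.erase a) y :=
        fun y hy => ih (l.erase a) ((sumSq_le_of_sublist hs).trans hV)
          (fun b hb => hpos b (hs.subset hb)) (fun l' hl' => H l' (hl'.trans hs)) hy
          (by rw [List.length_erase_of_mem ha, hn]; rfl)
      rw [sumSq_perm hp, tailProb_perm hp]
      refine potential_le_tailProb_cons hD (hfit _ ?_) (hfit _ ?_)
      · exact (abs_add_le x a).trans_lt (by rw [abs_of_nonneg ha0]; linarith)
      · exact (abs_sub x a).trans_lt (by rw [abs_of_nonneg ha0]; linarith)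

theorem countGE_cons (t a : ℝ) (l : List ℝ) [Decidable (t ≤ a)] :
    countGE t (a :: l) = countGE t l + if t ≤ a then 1 else 0 := by
  classical
  simp [countGE, List.countP_cons]

theorem countGE_perm (t : ℝ) {l l' : List ℝ} (h : l.Perm l') : countGE t l = countGE t l' := by
  classical
  exact h.countP_eq _

theorem countGE_le_of_sublist (t : ℝ) {l l' : List ℝ} (h : l'.Sublist l) :
    countGE t l' ≤ countGE t l := by
  classical
  exact h.countP_le

theorem countGE_le_length (t : ℝ) (l : List ℝ) : countGE t l ≤ l.length := by
  classical
  exact List.countP_le_length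

theorem countGE_eq_zero {t : ℝ} {l : List ℝ} (h : ∀ a ∈ l, a < t) : countGE t l = 0 := by
  classical
  simpa [countGE, List.countP_eq_zero] using h

/-- An entry bounding all others counts whenever any of them does. -/
theorem countGE_le_of_forall_le {t a : ℝ} {l : List ℝ} {N : ℕ} (ha : ∀ b ∈ l, b ≤ a)
    (h : countGE t (a :: l) ≤ N) : countGE t l ≤ N - 1 := by
  classical
  by_cases hta : t ≤ a
  · rw [countGE_cons, if_pos hta] at h
    omega
  · rw [countGE_eq_zero fun b hb => (ha b hb).trans_lt (not_le.1 hta)]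
    exact Nat.zero_le _

theorem sumSq_le_layers {s t u A B C D : ℝ} (l : List ℝ) (hpos : ∀ a ∈ l, 0 ≤ a)
    (hs : s ^ 2 ≤ A) (ht : t ^ 2 ≤ A + B) (hu : u ^ 2 ≤ A + B + C) (hst : s ≤ t) (htu : t ≤ u)
    (hl : ∀ a ∈ l, u ≤ a → a ^ 2 ≤ A + B + C + D) :
    sumSq l ≤ l.length * A + countGE s l * B + countGE t l * C + countGE u l * D := by
  classical
  induction l with
  | nil => simp [countGE]
  | cons a l ih =>
    have ih := ih (fun b hb => hpos b (List.mem_cons_of_mem _ hb))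
      fun b hb => hl b (List.mem_cons_of_mem _ hb)
    have ha := hpos a List.mem_cons_self
    rw [sumSq_cons, countGE_cons, countGE_cons, countGE_cons, List.length_cons]
    have : a ^ 2 ≤ A + (if s ≤ a then 1 else 0 : ℕ) * B + (if t ≤ a then 1 else 0 : ℕ) * C +
        (if u ≤ a then 1 else 0 : ℕ) * D := by
      by_cases h1 : u ≤ a
      · rw [if_pos h1, if_pos (htu.trans h1), if_pos (hst.trans (htu.trans h1))]
        have := hl a List.mem_cons_self h1
        push_cast; linarith
      by_cases h2 : t ≤ a
      · rw [if_neg h1, if_pos h2, if_pos (hst.trans h2)]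
        push_cast; nlinarith
      by_cases h3 : s ≤ a
      · rw [if_neg h1, if_neg h2, if_pos h3]
        push_cast; nlinarith
      · rw [if_neg h1, if_neg h2, if_neg h3]
        push_cast; nlinarith
    push_cast at this ⊢
    linarith

theorem exists_perm_cons_max (l : List ℝ) (h : l ≠ []) :
    ∃ (a : ℝ) (l' : List ℝ), l.Perm (a :: l') ∧ ∀ b ∈ l', b ≤ a := by
  obtain ⟨a, ha, hmax⟩ := l.toFinset.exists_max_image id (by simpa using h)
  simp only [List.mem_toFinset, id] at ha hmax
  exact ⟨a, l.erase a, List.perm_cons_erase ha, fun b hb => hmax b (List.mem_of_mem_erase hb)⟩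

theorem quarter_le_tailProb_of_one_le_add {p q : ℝ} (l : List ℝ) (h : 1 ≤ p + q) :
    1 / 4 ≤ tailProb (p :: q :: l) 0 := by
  have h1 := half_le_tailProb l (h.trans (le_abs_self _))
  have h2 := tailProb_neg l (p + q)
  rw [tailProb_cons, tailProb_cons, tailProb_cons]
  rw [show -(p + q) = 0 - p - q by ring] at h2
  rw [show p + q = 0 + p + q by ring] at h2 h1
  linarith [tailProb_nonneg l (0 + p - q), tailProb_nonneg l (0 - p + q)]

theorem layers_le_small {r n₁ n₂ : ℕ} {V : ℝ} (hr : 0 < r) (hr' : r < 25) (h₁ : n₁ ≤ min r 16)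
    (h₂ : n₂ ≤ min r 9) (hV : V ≤ r * (1 / 25) + n₁ * (9 / 400) + n₂ * (69 / 1600)) :
    V / 4 + 1 / 24 * (5 * V - 3 * V ^ 2) ≤ (1 - middleSum r 1 / 2 ^ r) / 2 := by
  have h₁' : (n₁ : ℝ) ≤ (min r 16 : ℕ) := by exact_mod_cast h₁
  have h₂' : (n₂ : ℝ) ≤ (min r 9 : ℕ) := by exact_mod_cast h₂
  have hV' : V ≤ r * (1 / 25) + (min r 16 : ℕ) * (9 / 400) + (min r 9 : ℕ) * (69 / 1600) := by
    linarith
  have h := sq_nonneg (V - (r * (1 / 25) + (min r 16 : ℕ) * (9 / 400) +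
    (min r 9 : ℕ) * (69 / 1600)))
  clear hV h₁ h₂ h₁' h₂'
  interval_cases r <;> norm_num [middleSum] at hV' h ⊢ <;> nlinarith

theorem layers_le_middle {r n₁ n₂ n₃ : ℕ} {V y w : ℝ} (hr : 0 < r) (hr' : r < 25)
    (h₁ : n₁ ≤ min r 15) (h₂ : n₂ ≤ min r 8) (h₃ : n₃ ≤ min r 3) (hy : 69 / 1600 ≤ y)
    (hy' : y ≤ 7 / 144) (hw : 0 ≤ w) (hV' : V ≤ 29 / 16 - 3 * y - 3 * w)
    (hV : V ≤ r * (1 / 25) + n₁ * (9 / 400) + n₂ * y + n₃ * w) :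
    V ≤ 2 * (1 - middleSum r 1 / 2 ^ r) := by
  have h₁' : (n₁ : ℝ) ≤ (min r 15 : ℕ) := by exact_mod_cast h₁
  have h₂' : (n₂ : ℝ) * y ≤ (min r 8 : ℕ) * y :=
    mul_le_mul_of_nonneg_right (by exact_mod_cast h₂) (by linarith)
  have h₃' : (n₃ : ℝ) * w ≤ (min r 3 : ℕ) * w :=
    mul_le_mul_of_nonneg_right (by exact_mod_cast h₃) hw
  have hV'' : V ≤ r * (1 / 25) + (min r 15 : ℕ) * (9 / 400) + (min r 8 : ℕ) * y +
    (min r 3 : ℕ) * w := by linarith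
  clear hV h₁ h₂ h₃ h₁' h₂' h₃'
  interval_cases r <;> norm_num [middleSum] at hV'' ⊢ <;> linarith

theorem layers_le_large {r n₃ : ℕ} {V w : ℝ} (hr : 0 < r) (hr' : r < 9) (h₃ : n₃ ≤ min r 4)
    (hw : 0 ≤ w) (hw' : w ≤ 5 / 36) (hV : V ≤ r * (1 / 9) + n₃ * w) :
    V ≤ 2 * (1 - middleSum r 1 / 2 ^ r) := by
  have h₃' : (n₃ : ℝ) * w ≤ (min r 4 : ℕ) * w :=
    mul_le_mul_of_nonneg_right (by exact_mod_cast h₃) hw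
  have hV' : V ≤ r * (1 / 9) + (min r 4 : ℕ) * w := by linarith
  clear hV h₃ h₃'
  interval_cases r <;> norm_num [middleSum] at hV' ⊢ <;> linarith

theorem layers_le_stuck {r n₁ n₃ : ℕ} {V w e : ℝ} (hr : 9 ≤ r) (hr' : r < 23) (h₁ : n₁ ≤ 8)
    (h₃ : n₃ ≤ 4) (hw : 0 ≤ w) (he : e ≤ 337 / 10000) (hV' : V ≤ 16 / 9 - 2 * w)
    (hV : V ≤ r * e + n₁ * (1 / 9 - e) + n₃ * w) :
    V ≤ 2 * (1 - middleSum r 1 / 2 ^ r) := by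
  have h₁' : (n₁ : ℝ) * (1 / 9 - e) ≤ 8 * (1 / 9 - e) :=
    mul_le_mul_of_nonneg_right (by exact_mod_cast h₁) (by linarith)
  have h₃' : (n₃ : ℝ) * w ≤ 4 * w :=
    mul_le_mul_of_nonneg_right (by exact_mod_cast h₃) hw
  have hV'' : V ≤ r * e + 8 * (1 / 9 - e) + 4 * w := by linarith
  clear hV h₁ h₃ h₁' h₃'
  interval_cases r <;> norm_num [middleSum] at hV'' ⊢ <;> linarith

theorem quarter_le_tailProb_of_small {p q c : ℝ} {l : List ℝ} (hp : 0 ≤ p) (hq : 0 ≤ q)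
    (hpq : p + q < 1) (hl : ∀ a ∈ c :: l, 0 ≤ a) (hc : c ≤ 13 / 40) (hlc : ∀ a ∈ l, a ≤ c)
    (hV : sumSq (p :: q :: c :: l) = 2)
    (h4 : countGE (1 / 4) (c :: l) ≤ 9) (h5 : countGE (1 / 5) (c :: l) ≤ 16) :
    1 / 4 ≤ tailProb (p :: q :: c :: l) 0 := by
  have hV' : sumSq (c :: l) ≤ 2 := by
    rw [← hV]
    exact sumSq_le_of_sublist (.cons _ (.cons _ (.refl _)))
  have key : ∀ x, |x| < 1 → potential (1 / 24) x (sumSq (c :: l)) ≤ tailProb (c :: l) x := by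
    refine fun x hx => potential_le_tailProb (by norm_num) (by norm_num) _ hV' hl ?_ hx
    intro l' hl' hne
    have hlen : 0 < l'.length := List.length_pos_of_ne_nil hne
    set V := sumSq l'
    by_cases hr : 25 ≤ l'.length
    · refine ⟨25, hr, ?_⟩
      norm_num [middleSum]
      nlinarith [sq_nonneg (V - 11 / 6)]
    · refine ⟨l'.length, le_rfl, ?_⟩
      have hb : V ≤ l'.length * (1 / 25) + countGE (1 / 5) l' * (9 / 400) +
          countGE (1 / 4) l' * (69 / 1600) + countGE (13 / 40) l' * 0 := by
        refine sumSq_le_layers l' (fun a ha => hl a (hl'.subset ha)) (by norm_num) (by norm_num)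
          (by norm_num) (by norm_num) (by norm_num) fun a ha _ => ?_
        have ha0 := hl a (hl'.subset ha)
        have : a ≤ c := by
          rcases List.mem_cons.1 (hl'.subset ha) with rfl | h
          exacts [le_rfl, hlc a h]
        nlinarith
      exact layers_le_small hlen (not_le.1 hr)
        (le_min (countGE_le_length _ _) ((countGE_le_of_sublist _ hl').trans h5))
        (le_min (countGE_le_length _ _) ((countGE_le_of_sublist _ hl').trans h4)) (by linarith)
  have hfin : potential (1 / 24) 0 (sumSq (p :: q :: c :: l)) ≤ tailProb (p :: q :: c :: l) 0 := by
    refine potential_le_tailProb_cons (by norm_num) ?_ ?_ <;>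
      refine potential_le_tailProb_cons (by norm_num) (key _ ?_) (key _ ?_) <;>
      rw [abs_lt] <;> constructor <;> linarith
  rw [hV] at hfin
  norm_num [potential] at hfin ⊢
  exact hfin

theorem quarter_le_tailProb_of_mul_le {p q c : ℝ} {l : List ℝ} (hq : q ≤ p) (hcq : c ≤ q)
    (hpq : p + q < 1) (hl : ∀ a ∈ l, 0 ≤ a) (hc : 13 / 40 ≤ c) (hlc : ∀ a ∈ l, a ≤ c)
    (hV : sumSq (p :: q :: c :: l) = 2) (he : p * q + p * c + q * c ≤ 1 / 2)
    (h3 : countGE (1 / 3) l ≤ 3) (h4 : countGE (1 / 4) l ≤ 8) (h5 : countGE (1 / 5) l ≤ 15) :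
    1 / 4 ≤ tailProb (p :: q :: c :: l) 0 := by
  have hVl : p ^ 2 + (q ^ 2 + (c ^ 2 + sumSq l)) = 2 := by simpa using hV
  have hVc : sumSq l ≤ 2 - 3 * c ^ 2 := by nlinarith
  have key : ∀ x, |x| < 1 → potential 0 x (sumSq l) ≤ tailProb l x := by
    refine fun x hx => potential_le_tailProb le_rfl (by norm_num) _ (by nlinarith) hl ?_ hx
    intro l' hl' hne
    have hlen : 0 < l'.length := List.length_pos_of_ne_nil hne
    have hV' := sumSq_le_of_sublist hl'
    have hn3 : countGE (1 / 3) l' ≤ min l'.length 3 :=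
      le_min (countGE_le_length _ _) ((countGE_le_of_sublist _ hl').trans h3)
    have hn4 : countGE (1 / 4) l' ≤ min l'.length 8 :=
      le_min (countGE_le_length _ _) ((countGE_le_of_sublist _ hl').trans h4)
    have hn5 : countGE (1 / 5) l' ≤ min l'.length 15 :=
      le_min (countGE_le_length _ _) ((countGE_le_of_sublist _ hl').trans h5)
    have hpos : ∀ a ∈ l', 0 ≤ a := fun a ha => hl a (hl'.subset ha)
    have hsq : ∀ a ∈ l', a ^ 2 ≤ c ^ 2 := fun a ha =>
      pow_le_pow_left₀ (hpos a ha) (hlc a (hl'.subset ha)) 2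
    by_cases hr : 25 ≤ l'.length
    · refine ⟨25, hr, ?_⟩
      norm_num [middleSum]
      nlinarith
    · refine ⟨l'.length, le_rfl, ?_⟩
      have : sumSq l' ≤ 2 * (1 - middleSum l'.length 1 / 2 ^ l'.length) := by
        by_cases hc3 : c < 1 / 3
        · refine layers_le_middle (y := c ^ 2 - 1 / 16) (w := 0) hlen (not_le.1 hr) hn5 hn4 hn3
            (by nlinarith) (by nlinarith) le_rfl (by linarith) ?_
          have := sumSq_le_layers (s := 1 / 5) (t := 1 / 4) (u := c) (A := 1 / 25) (B := 9 / 400)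
            (C := c ^ 2 - 1 / 16) (D := 0) l' hpos (by norm_num) (by norm_num) (by linarith)
            (by norm_num) (by linarith) fun a ha _ => by linarith [hsq a ha]
          linarith
        · refine layers_le_middle (y := 7 / 144) (w := c ^ 2 - 1 / 9) hlen (not_le.1 hr) hn5 hn4
            hn3 (by norm_num) le_rfl (by nlinarith) (by linarith) ?_
          have := sumSq_le_layers (s := 1 / 5) (t := 1 / 4) (u := 1 / 3) (A := 1 / 25)
            (B := 9 / 400) (C := 7 / 144) (D := c ^ 2 - 1 / 9) l' hpos (by norm_num)
            (by norm_num) (by norm_num) (by norm_num) (by norm_num)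
            fun a ha _ => by linarith [hsq a ha]
          linarith
      linarith
  have k0 : potential 0 (0 + p + q + c) (sumSq l) ≤ tailProb l (0 + p + q + c) := by
    by_cases h : |0 + p + q + c| < 1
    · exact key _ h
    · refine le_trans ?_ (half_le_tailProb l (not_lt.1 h))
      simp only [potential]
      nlinarith
  have k0' : potential 0 (0 - p - q - c) (sumSq l) ≤ tailProb l (0 - p - q - c) := by
    rw [show 0 - p - q - c = -(0 + p + q + c) by ring, tailProb_neg]
    rwa [potential_neg]
  have hfin : potential 0 0 (sumSq (p :: q :: c :: l)) ≤ tailProb (p :: q :: c :: l) 0 := by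
    refine potential_le_tailProb_cons le_rfl ?_ ?_ <;>
      refine potential_le_tailProb_cons le_rfl ?_ ?_ <;>
      refine potential_le_tailProb_cons le_rfl ?_ ?_ <;>
      first
      | exact k0
      | exact k0'
      | (refine key _ ?_; rw [abs_lt]; constructor <;> linarith)
  rw [hV] at hfin
  norm_num [potential] at hfin ⊢
  exact hfin

theorem quarter_le_tailProb_of_lt_mul {p q c : ℝ} {l : List ℝ} (hq : q ≤ p) (hcq : c ≤ q)
    (hc : 0 ≤ c) (hpq : p + q < 1) (hl : ∀ a ∈ l, 0 ≤ a) (hlc : ∀ a ∈ l, a ≤ c)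
    (hV : sumSq (p :: q :: c :: l) = 2) (he : 1 / 2 < p * q + p * c + q * c)
    (h3 : countGE (1 / 3) (c :: l) ≤ 4) :
    1 / 4 ≤ tailProb (p :: q :: c :: l) 0 := by
  have hVl : p ^ 2 + (q ^ 2 + (c ^ 2 + sumSq l)) = 2 := by simpa using hV
  have hVu : sumSq l ≤ 3 / 2 := by
    linarith [sq_nonneg (p - q), sq_nonneg (p - c), sq_nonneg (q - c)]
  have hs : 2 / 3 < (p + q) ^ 2 := by nlinarith [sq_nonneg (p - q)]
  have hu : 1 / 3 < p ^ 2 + q ^ 2 := by linarith [sq_nonneg (p - q)]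
  have hm : 2 * (p * q) ≤ 1 / 2 := by nlinarith [sq_nonneg (p - q)]
  have hqp : q ^ 2 ≤ p ^ 2 := pow_le_pow_left₀ (hc.trans hcq) hq 2
  have hd : (1 - (p + q)) ^ 2 ≤ 337 / 10000 := by
    have : 8164 / 10000 < p + q := by nlinarith
    nlinarith
  have hd3 : 1 - (p + q) ≤ 1 / 3 := by nlinarith
  set w := max (q ^ 2 - 1 / 9) 0 with hw
  have hw0 : 0 ≤ w := le_max_right _ _
  have hwq : q ^ 2 ≤ 1 / 9 + w := by linarith [le_max_left (q ^ 2 - 1 / 9) 0]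
  have hw1 : w ≤ 5 / 36 := max_le (by nlinarith) (by norm_num)
  have hcl : ∀ a ∈ c :: l, 0 ≤ a ∧ a ≤ q := by
    intro a ha
    rcases List.mem_cons.1 ha with rfl | h
    exacts [⟨hc, hcq⟩, ⟨hl a h, (hlc a h).trans hcq⟩]
  have layers : ∀ l' : List ℝ, l'.Sublist (c :: l) → ∀ d e : ℝ, d ≤ 1 / 3 → d ^ 2 ≤ e →
      sumSq l' ≤ l'.length * e + countGE d l' * (1 / 9 - e) + countGE (1 / 3) l' * w := by
    intro l' hl' d e hd hde
    have := sumSq_le_layers (s := d) (t := 1 / 3) (u := 1 / 3) (A := e)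
      (B := 1 / 9 - e) (C := 0) (D := w) l' (fun a ha => (hcl a (hl'.subset ha)).1) hde
      (by norm_num) (by norm_num) hd le_rfl fun a ha _ => by
        have := hcl a (hl'.subset ha)
        linarith [pow_le_pow_left₀ this.1 this.2 2]
    linarith
  have short : ∀ l' : List ℝ, l'.Sublist (c :: l) → l' ≠ [] → l'.length < 9 →
      sumSq l' ≤ 2 * (1 - middleSum l'.length 1 / 2 ^ l'.length) := by
    intro l' hl' hne hr
    refine layers_le_large (List.length_pos_of_ne_nil hne) hr
      (le_min (countGE_le_length (1 / 3) _) ((countGE_le_of_sublist _ hl').trans h3)) hw0 hw1 ?_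
    have := layers l' hl' (1 / 3) (1 / 9) le_rfl (by norm_num)
    linarith
  have hdiff : ∀ x, |x| < 1 → potential 0 x (sumSq l) ≤ tailProb l x := by
    refine fun x hx => potential_le_tailProb le_rfl (by norm_num) _ (by linarith) hl ?_ hx
    intro l' hl' hne
    have hV' := sumSq_le_of_sublist hl'
    by_cases hr : 9 ≤ l'.length
    · refine ⟨9, hr, ?_⟩
      norm_num [middleSum]
      linarith
    · refine ⟨l'.length, le_rfl, ?_⟩
      linarith [short l' (hl'.trans (List.sublist_cons_self _ _)) hne (not_le.1 hr)]
  have hsum : potential 0 (0 + p + q) (sumSq (c :: l)) ≤ tailProb (c :: l) (0 + p + q) := by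
    have hx : |0 + p + q| = p + q := by rw [zero_add, abs_of_nonneg]; linarith
    have hx1 : |0 + p + q| < 1 := hx.trans_lt hpq
    have hVx : sumSq (c :: l) = 2 - p ^ 2 - q ^ 2 := by rw [sumSq_cons]; linarith
    by_cases h9 : 9 ≤ countGE (1 - |0 + p + q|) (c :: l)
    · refine le_trans ?_ (le_tailProb_of_countGE hx1 h9)
      norm_num [middleSum, potential]
      linarith
    rw [hx] at h9
    refine potential_le_tailProb le_rfl (by norm_num) _ (by linarith)
      (fun a ha => (hcl a ha).1) ?_ hx1
    intro l' hl' hne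
    have hV' := sumSq_le_of_sublist hl'
    by_cases hr : 23 ≤ l'.length
    · refine ⟨23, hr, ?_⟩
      norm_num [middleSum]
      linarith
    refine ⟨l'.length, le_rfl, ?_⟩
    by_cases hr9 : l'.length < 9
    · linarith [short l' hl' hne hr9]
    have := layers_le_stuck (V := sumSq l') (w := w) (not_lt.1 hr9) (not_le.1 hr)
      ((countGE_le_of_sublist (1 - (p + q)) hl').trans (by omega))
      ((countGE_le_of_sublist (1 / 3) hl').trans h3) hw0 hd
      (by
        rcases max_choice (q ^ 2 - 1 / 9) 0 with h | h <;> rw [hw, h] <;> linarith)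
      (layers l' hl' _ _ hd3 le_rfl)
    linarith
  have hsum' : potential 0 (0 - p - q) (sumSq (c :: l)) ≤ tailProb (c :: l) (0 - p - q) := by
    rw [show 0 - p - q = -(0 + p + q) by ring, tailProb_neg]
    rwa [potential_neg]
  have hfin : potential 0 0 (sumSq (p :: q :: c :: l)) ≤ tailProb (p :: q :: c :: l) 0 := by
    refine potential_le_tailProb_cons le_rfl ?_ ?_ <;>
      refine potential_le_tailProb_cons le_rfl ?_ ?_ <;>
      first
      | exact hsum
      | exact hsum'
      | (refine potential_le_tailProb_cons le_rfl (hdiff _ ?_) (hdiff _ ?_) <;>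
          rw [abs_lt] <;> constructor <;> linarith)
  rw [hV] at hfin
  norm_num [potential] at hfin ⊢
  exact hfin

theorem quarter_le_tailProb_of_ordered {p q c : ℝ} {l : List ℝ}
    (hpos : ∀ a ∈ p :: q :: c :: l, 0 ≤ a)
    (hp : ∀ a ∈ q :: c :: l, a ≤ p) (hq : ∀ a ∈ c :: l, a ≤ q) (hc : ∀ a ∈ l, a ≤ c)
    (hV : sumSq (p :: q :: c :: l) = 2) : 1 / 4 ≤ tailProb (p :: q :: c :: l) 0 := by
  rcases le_or_gt 1 (p + q) with h | hpq
  · exact quarter_le_tailProb_of_one_le_add _ h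
  rcases le_or_gt 7 (countGE (1 / (3 : ℕ)) (p :: q :: c :: l)) with h | h3
  · refine le_trans ?_ (le_tailProb_zero_of_countGE _ (by norm_num) h)
    norm_num [middleSum]
  rcases le_or_gt 12 (countGE (1 / (4 : ℕ)) (p :: q :: c :: l)) with h | h4
  · refine le_trans ?_ (le_tailProb_zero_of_countGE _ (by norm_num) h)
    norm_num [middleSum]
  rcases le_or_gt 19 (countGE (1 / (5 : ℕ)) (p :: q :: c :: l)) with h | h5
  · refine le_trans ?_ (le_tailProb_zero_of_countGE _ (by norm_num) h)
    norm_num [middleSum]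
  push_cast at h3 h4 h5
  have e3 := countGE_le_of_forall_le hq (countGE_le_of_forall_le hp (Nat.le_of_lt_succ h3))
  have e4 := countGE_le_of_forall_le hq (countGE_le_of_forall_le hp (Nat.le_of_lt_succ h4))
  have e5 := countGE_le_of_forall_le hq (countGE_le_of_forall_le hp (Nat.le_of_lt_succ h5))
  have hp0 : 0 ≤ p := hpos p (by simp)
  have hq0 : 0 ≤ q := hpos q (by simp)
  have hc0 : 0 ≤ c := hpos c (by simp)
  have hl : ∀ a ∈ l, 0 ≤ a := fun a ha => hpos a (by simp [ha])
  have hqp : q ≤ p := hp q (by simp)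
  have hcq : c ≤ q := hq c (by simp)
  rcases le_total c (13 / 40) with hc' | hc'
  · exact quarter_le_tailProb_of_small hp0 hq0 hpq (fun a ha => hpos a (by simp_all)) hc' hc hV
      e4 e5
  rcases le_or_gt (p * q + p * c + q * c) (1 / 2) with he | he
  · exact quarter_le_tailProb_of_mul_le hqp hcq hpq hl hc' hc hV he
      (countGE_le_of_forall_le hc e3) (countGE_le_of_forall_le hc e4)
      (countGE_le_of_forall_le hc e5)
  · exact quarter_le_tailProb_of_lt_mul hqp hcq hc0 hpq hl hc hV he e3

theorem quarter_le_tailProb {l : List ℝ} (hpos : ∀ a ∈ l, 0 ≤ a) (hV : sumSq l = 2) :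
    1 / 4 ≤ tailProb l 0 := by
  have hpad : tailProb (0 :: 0 :: 0 :: l) 0 = tailProb l 0 := by
    simp [tailProb_cons]
  obtain ⟨p, l₁, h₁, hp⟩ := exists_perm_cons_max (0 :: 0 :: 0 :: l) (by simp)
  have len₁ := h₁.length_eq
  obtain ⟨q, l₂, h₂, hq⟩ := exists_perm_cons_max l₁ (by rintro rfl; simp at len₁)
  have len₂ := h₂.length_eq
  obtain ⟨c, l₃, h₃, hc⟩ := exists_perm_cons_max l₂ (by
    rintro rfl; simp at len₁ len₂; omega)
  have hperm : (0 :: 0 :: 0 :: l).Perm (p :: q :: c :: l₃) :=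
    h₁.trans (.cons _ (h₂.trans (.cons _ h₃)))
  rw [← hpad, tailProb_perm hperm]
  refine quarter_le_tailProb_of_ordered (fun a ha => ?_)
    (fun a ha => hp a ((h₂.trans (.cons _ h₃)).mem_iff.2 ha)) (fun a ha => hq a (h₃.mem_iff.2 ha))
    hc (by rw [← sumSq_perm hperm]; simpa using hV)
  have : a = 0 ∨ a ∈ l := by simpa using hperm.mem_iff.2 ha
  rcases this with rfl | h
  exacts [le_rfl, hpos a h]

theorem card_filter_eq_tailProb (m : ℕ) (a : Fin m → ℝ) (x : ℝ) :
    ((Finset.univ.filter fun ε : Fin m → Bool => 1 ≤ |x + ∑ i, a i * rsign (ε i)|).card : ℝ)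
      = 2 ^ m * tailProb (List.ofFn a) x := by
  induction m generalizing x with
  | zero =>
    simp [tailProb, signedMean, Set.indicator_apply]
    split_ifs <;> simp
  | succ m ih =>
    rw [List.ofFn_succ, tailProb_cons]
    have h := ih (fun i => a i.succ)
    rw [Finset.card_filter, ← (Fin.consEquiv fun _ => Bool).sum_comp, Fintype.sum_prod_type]
    simp only [Fintype.sum_bool, Fin.consEquiv, Equiv.coe_fn_mk, Fin.sum_univ_succ, Fin.cons_zero,
      Fin.cons_succ, ← add_assoc, ← Finset.card_filter]
    rw [Nat.cast_add, h, h]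
    simp [rsign, ← sub_eq_add_neg]
    ring

/-- If `Y = ∑ a i * Y i` with `Y i` independent uniform ±1 (modeled by a uniform
boolean vector), then `Pr[|Y| ≥ (∑ a i ^ 2)^{1/2} / √2] ≥ 1/4`. -/
theorem stmt0 (m : ℕ) (a : Fin m → ℝ) :
    (((Finset.univ.filter (fun ε : Fin m → Bool =>
        Real.sqrt (∑ i, a i ^ 2) / Real.sqrt 2 ≤ |∑ i, a i * rsign (ε i)|)).card : ℝ)
      / 2 ^ m) ≥ 1 / 4 := by
  rw [ge_iff_le, le_div_iff₀ (by positivity)]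
  have hnn : 0 ≤ ∑ i, a i ^ 2 := Finset.sum_nonneg fun i _ => sq_nonneg (a i)
  rcases hnn.eq_or_lt with h0 | h0
  · have hle : ∀ y : ℝ, √(∑ i, a i ^ 2) / √2 ≤ |y| := fun y => by simp [← h0]
    rw [Finset.filter_true_of_mem fun ε _ => hle _]
    simp
    linarith [pow_pos (two_pos (α := ℝ)) m]
  · set k := √2 / √(∑ i, a i ^ 2) with hk
    have hS : 0 < √(∑ i, a i ^ 2) := Real.sqrt_pos.2 h0
    have h2 : 0 < √(2 : ℝ) := Real.sqrt_pos.2 two_pos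
    have hk0 : 0 < k := div_pos h2 hS
    have hiff : ∀ y : ℝ, √(∑ i, a i ^ 2) / √2 ≤ |y| ↔ 1 ≤ |0 + k * y| := fun y => by
      rw [zero_add, abs_mul, abs_of_pos hk0, hk, div_le_iff₀ h2, div_mul_eq_mul_div,
        le_div_iff₀ hS, one_mul, mul_comm]
    have hsum : ∀ ε : Fin m → Bool, k * ∑ i, a i * rsign (ε i) = ∑ i, k * a i * rsign (ε i) :=
      fun ε => by simp only [Finset.mul_sum, mul_assoc]
    simp only [hiff, hsum]
    rw [card_filter_eq_tailProb m (fun i => k * a i) 0, mul_comm]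
    refine mul_le_mul_of_nonneg_left ?_ (by positivity)
    rw [tailProb, ← signedMean.map_abs]
    refine quarter_le_tailProb (by simp [-abs_mul]) ?_
    simp only [sumSq, Function.comp_def, sq_abs, List.map_ofFn, List.sum_ofFn,
      mul_pow, ← Finset.mul_sum]
    rw [hk, div_pow, Real.sq_sqrt zero_le_two, Real.sq_sqrt h0.le, div_mul_cancel₀ _ h0.ne']
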